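/- arXiv:1201.5065 — 7 statements merged into one kernel-verified Lean document; each statement's English description precedes it below -/
import Mathlib

section
/- Implicit L theorem: Let F be a field, let H1 be an n×n matrix over F, and let L and L' be unit lower triangular n×n matrices such that H2 := L⁻¹·H1·L and H2' := L'⁻¹·H1·L' are both unreduced upper Hessenberg matrices. If L and L' have the same first column (L·e1 = L'·e1), then L = L' and H2 = H2'. -/
open Matrix

/-- A lower triangular matrix with unit diagonal and first column `e₁` which intertwines two upper
Hessenberg matrices, the second one unreduced, is the identity. -/
theorem eq_one_of_intertwines_hessenberg {F : Type*} [Field F] {n : ℕ} (hn : 0 < n)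
    (G H K : Matrix (Fin n) (Fin n) F)
    (hlow : ∀ i j : Fin n, i < j → G i j = 0) (hdiag : ∀ i : Fin n, G i i = 1)
    (hcol : ∀ i : Fin n, G i ⟨0, hn⟩ = (1 : Matrix (Fin n) (Fin n) F) i ⟨0, hn⟩)
    (hH : ∀ i j : Fin n, (j : ℕ) + 1 < (i : ℕ) → H i j = 0)
    (hK : ∀ i j : Fin n, (j : ℕ) + 1 < (i : ℕ) → K i j = 0)
    (hKunred : ∀ j : Fin n, ∀ h : (j : ℕ) + 1 < n, K ⟨(j : ℕ) + 1, h⟩ j ≠ 0)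
    (hGK : G * K = H * G) : G = 1 := by
  have key : ∀ m : ℕ, ∀ hm : m < n, ∀ i : Fin n,
      G i ⟨m, hm⟩ = (1 : Matrix (Fin n) (Fin n) F) i ⟨m, hm⟩ := by
    intro m
    induction m using Nat.strong_induction_on with
    | _ m ih =>
      intro hm i
      obtain _ | j := m
      · exact hcol i
      rcases lt_trichotomy i ⟨j + 1, hm⟩ with hi | rfl | hi
      · rw [hlow _ _ hi, one_apply_ne hi.ne]
      · rw [hdiag, one_apply_eq]
      rw [one_apply_ne hi.ne']
      have hi' : j + 1 < (i : ℕ) := hi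
      have hj : j < n := by omega
      have hentry := congrFun (congrFun hGK i) ⟨j, hj⟩
      have hright : (H * G) i ⟨j, hj⟩ = 0 := by
        have : (H * G) i ⟨j, hj⟩ = (H * (1 : Matrix (Fin n) (Fin n) F)) i ⟨j, hj⟩ := by
          simp only [mul_apply, ih j j.lt_succ_self hj]
        rw [this, mul_one, hH _ _ hi']
      rw [hright, mul_apply, Finset.sum_eq_single ⟨j + 1, hm⟩] at hentry
      · exact (mul_eq_zero.mp hentry).resolve_right (hKunred ⟨j, hj⟩ hm)
      · intro k _ hk
        rcases lt_or_gt_of_ne hk with hk | hk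
        · have hne : i ≠ k := (hk.trans hi).ne'
          rw [ih k hk k.isLt i, one_apply_ne hne, zero_mul]
        · rw [hK k ⟨j, hj⟩ hk, mul_zero]
      · simp
  ext i j
  exact key j j.isLt i

theorem isUnit_det_of_unit_lower {F : Type*} [Field F] {n : ℕ} (L : Matrix (Fin n) (Fin n) F)
    (hlow : ∀ i j : Fin n, i < j → L i j = 0) (hdiag : ∀ i : Fin n, L i i = 1) :
    IsUnit L.det := by
  have hL : L.BlockTriangular OrderDual.toDual := fun i j h => hlow i j h
  simp [det_of_isLowerTriangular L hL, hdiag]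

/-- Implicit L theorem: if `L⁻¹ * H1 * L` and `L'⁻¹ * H1 * L'` are both unreduced upper
Hessenberg, `L, L'` are unit lower triangular and have the same first column, then
`L = L'` and the two Hessenberg matrices coincide. -/
theorem implicit_L_theorem {F : Type*} [Field F] {n : ℕ} (hn : 0 < n)
    (H1 L L' : Matrix (Fin n) (Fin n) F)
    (hLlow : ∀ i j : Fin n, i < j → L i j = 0) (hLdiag : ∀ i : Fin n, L i i = 1)
    (hL'low : ∀ i j : Fin n, i < j → L' i j = 0) (hL'diag : ∀ i : Fin n, L' i i = 1)
    (hH2hess : ∀ i j : Fin n, (j : ℕ) + 1 < (i : ℕ) → (L⁻¹ * H1 * L) i j = 0)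
    (hH2unred : ∀ j : Fin n, ∀ h : (j : ℕ) + 1 < n,
      (L⁻¹ * H1 * L) ⟨(j : ℕ) + 1, h⟩ j ≠ 0)
    (hH2'hess : ∀ i j : Fin n, (j : ℕ) + 1 < (i : ℕ) → (L'⁻¹ * H1 * L') i j = 0)
    (hH2'unred : ∀ j : Fin n, ∀ h : (j : ℕ) + 1 < n,
      (L'⁻¹ * H1 * L') ⟨(j : ℕ) + 1, h⟩ j ≠ 0)
    (hcol : ∀ i : Fin n, L i ⟨0, hn⟩ = L' i ⟨0, hn⟩) :
    L = L' ∧ L⁻¹ * H1 * L = L'⁻¹ * H1 * L' := by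
  have hL := isUnit_det_of_unit_lower L hLlow hLdiag
  have hL' := isUnit_det_of_unit_lower L' hL'low hL'diag
  have hLtri : L.BlockTriangular OrderDual.toDual := fun i j h => hLlow i j h
  have hL'tri : L'.BlockTriangular OrderDual.toDual := fun i j h => hL'low i j h
  have hGtri : (L⁻¹ * L').BlockTriangular OrderDual.toDual := by
    let := invertibleOfIsUnitDet L hL
    exact (blockTriangular_inv_of_blockTriangular hLtri).mul hL'tri
  have hLG : L * (L⁻¹ * L') = L' := mul_nonsing_inv_cancel_left L L' hL
  have hG : L⁻¹ * L' = 1 := by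
    refine eq_one_of_intertwines_hessenberg hn _ (L⁻¹ * H1 * L) (L'⁻¹ * H1 * L')
      (fun i j h => hGtri h) (fun i => ?_) (fun i => ?_) hH2hess hH2'hess hH2'unred ?_
    · have h := congrFun (congrFun hLG i) i
      rw [mul_apply, Finset.sum_eq_single i, hLdiag, hL'diag, one_mul] at h
      · exact h
      · intro k _ hk
        rcases lt_or_gt_of_ne hk with hk | hk
        · rw [hGtri (show OrderDual.toDual i < OrderDual.toDual k from hk), mul_zero]
        · rw [hLlow i k hk, zero_mul]
      · simp
    · rw [← nonsing_inv_mul L hL, mul_apply, mul_apply]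
      simp only [hcol]
    · simp only [Matrix.mul_assoc, mul_nonsing_inv_cancel_left _ _ hL,
        mul_nonsing_inv_cancel_left _ _ hL']
  have hEq : L = L' := by rw [← hLG, hG, mul_one]
  exact ⟨hEq, by rw [hEq]⟩
end

section
/- Double-shift LR product identity: let J2 be an n×n matrix over a commutative ring, let σ1, σ2 be scalars, and suppose J2 − σ1·I = L2·U2, J3 = U2·L2 + σ1·I, and J3 − σ2·I = L3·U3 for some matrices L2, U2, L3, U3. Then (L2·L3)·(U3·U2) = (J2 − σ1·I)·(J2 − σ2·I) = J2² − (σ1+σ2)·J2 + σ1·σ2·I. -/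
open Matrix

/-- Double-shift LR product identity:
`(L2·L3)·(U3·U2) = (J2 − σ1·I)·(J2 − σ2·I) = J2² − (σ1+σ2)·J2 + σ1·σ2·I`. -/
theorem double_shift_LR_product_identity {R : Type*} [CommRing R] {n : ℕ}
    (J2 J3 L2 U2 L3 U3 : Matrix (Fin n) (Fin n) R) (σ1 σ2 : R)
    (h1 : J2 - σ1 • (1 : Matrix (Fin n) (Fin n) R) = L2 * U2)
    (h2 : J3 = U2 * L2 + σ1 • (1 : Matrix (Fin n) (Fin n) R))
    (h3 : J3 - σ2 • (1 : Matrix (Fin n) (Fin n) R) = L3 * U3) :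
    (L2 * L3) * (U3 * U2) =
      (J2 - σ1 • (1 : Matrix (Fin n) (Fin n) R)) * (J2 - σ2 • (1 : Matrix (Fin n) (Fin n) R)) ∧
    (J2 - σ1 • (1 : Matrix (Fin n) (Fin n) R)) * (J2 - σ2 • (1 : Matrix (Fin n) (Fin n) R)) =
      J2 ^ 2 - (σ1 + σ2) • J2 + (σ1 * σ2) • (1 : Matrix (Fin n) (Fin n) R) := by
  constructor
  · have hJ : J2 = L2 * U2 + σ1 • (1 : Matrix (Fin n) (Fin n) R) := sub_eq_iff_eq_add.mp h1
    calc (L2 * L3) * (U3 * U2) = L2 * (L3 * U3) * U2 := by simp only [Matrix.mul_assoc]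
      _ = _ := by
        rw [← h3, h2, h1, hJ]
        simp only [mul_add, add_mul, mul_sub, sub_mul, Matrix.mul_smul, Matrix.smul_mul,
          Matrix.mul_one, Matrix.mul_assoc]
  · simp only [mul_sub, sub_mul, Matrix.mul_smul, Matrix.smul_mul, Matrix.mul_one,
      Matrix.one_mul, pow_two, add_smul, smul_smul, mul_comm σ2 σ1]
    abel
end

section
/- Correctness of the qds(σ) recurrence: with L, U as in the context and σ ∈ F, suppose û_1,…,û_n and l̂_1,…,l̂_{n−1} satisfy û_1 = u_1 + l_1 − σ, l̂_i = l_i·u_{i+1}/û_i and û_{i+1} = u_{i+1} + l_{i+1} − σ − l̂_i for i = 1,…,n−1 (with the convention l_n = 0), where û_i ≠ 0 for i = 1,…,n−1. Let L̂ be the unit lower bidiagonal matrix with subdiagonal entries l̂_1,…,l̂_{n−1} and Û the upper bidiagonal matrix with diagonal entries û_1,…,û_n and superdiagonal entries 1. Then L̂·Û = U·L − σ·I. -/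
open Matrix

theorem sum_upper_bidiagonal_row_mul {R : Type*} [Semiring R] {n i : ℕ} (hi : i < n) (a : R)
    (g : ℕ → R) :
    ∑ k : Fin n, (if i = (k : ℕ) then a else if (k : ℕ) = i + 1 then 1 else 0) * g k =
      a * g i + if i + 1 < n then g (i + 1) else 0 := by
  have split (k : ℕ) : (if i = k then a else if k = i + 1 then 1 else 0) * g k =
      (if i = k then a * g k else 0) + if i + 1 = k then g k else 0 := by
    split_ifs <;> first | omega | simp
  rw [Fin.sum_univ_eq_sum_range
    (fun k ↦ (if i = k then a else if k = i + 1 then 1 else 0) * g k) n]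
  simp [split, Finset.sum_add_distrib, hi]

theorem sum_lower_bidiagonal_row_zero_mul {R : Type*} [Semiring R] {n : ℕ} (hn : 0 < n)
    (c g : ℕ → R) :
    ∑ k : Fin n, (if 0 = (k : ℕ) + 1 then c k else if 0 = (k : ℕ) then 1 else 0) * g k = g 0 := by
  rw [Fin.sum_univ_eq_sum_range
    (fun k ↦ (if 0 = k + 1 then c k else if 0 = k then 1 else 0) * g k) n]
  simp [hn]

theorem sum_lower_bidiagonal_row_succ_mul {R : Type*} [Semiring R] {n i : ℕ} (hi : i + 1 < n)
    (c g : ℕ → R) :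
    ∑ k : Fin n, (if i + 1 = (k : ℕ) + 1 then c k else if i + 1 = (k : ℕ) then 1 else 0) * g k =
      c i * g i + g (i + 1) := by
  have split (k : ℕ) : (if i + 1 = k + 1 then c k else if i + 1 = k then 1 else 0) * g k =
      (if i = k then c k * g k else 0) + if i + 1 = k then g k else 0 := by
    split_ifs <;> first | omega | simp
  rw [Fin.sum_univ_eq_sum_range
    (fun k ↦ (if i + 1 = k + 1 then c k else if i + 1 = k then 1 else 0) * g k) n]
  simp only [split, Finset.sum_add_distrib]
  simp [hi, (Nat.lt_succ_self i).trans hi]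

/-- Correctness of the `qds(σ)` recurrence: with the convention `l_n = 0`
(here, 0-indexed, `l (n-1) = 0`), the computed factors satisfy `L̂·Û = U·L − σ·I`. -/
theorem qds_recurrence_correct {F : Type*} [Field F] {n : ℕ} (hn : 1 ≤ n)
    (l u lh uh : ℕ → F) (σ : F)
    (L U Lh Uh : Matrix (Fin n) (Fin n) F)
    (hL : L = Matrix.of fun i j : Fin n =>
      if (i : ℕ) = (j : ℕ) + 1 then l (j : ℕ) else if i = j then 1 else 0)
    (hU : U = Matrix.of fun i j : Fin n =>
      if i = j then u (i : ℕ) else if (j : ℕ) = (i : ℕ) + 1 then 1 else 0)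
    (hLh : Lh = Matrix.of fun i j : Fin n =>
      if (i : ℕ) = (j : ℕ) + 1 then lh (j : ℕ) else if i = j then 1 else 0)
    (hUh : Uh = Matrix.of fun i j : Fin n =>
      if i = j then uh (i : ℕ) else if (j : ℕ) = (i : ℕ) + 1 then 1 else 0)
    -- convention l_n = 0
    (hconv : l (n - 1) = 0)
    -- the qds(σ) recurrence
    (h1 : uh 0 = u 0 + l 0 - σ)
    (hne : ∀ i : ℕ, i + 1 < n → uh i ≠ 0)
    (hlh : ∀ i : ℕ, i + 1 < n → lh i = l i * u (i + 1) / uh i)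
    (hrec : ∀ i : ℕ, i + 1 < n → uh (i + 1) = u (i + 1) + l (i + 1) - σ - lh i) :
    Lh * Uh = U * L - σ • (1 : Matrix (Fin n) (Fin n) F) := by
  subst hL hU hLh hUh
  ext ⟨i, hi⟩ ⟨j, hj⟩
  simp only [mul_apply, Matrix.sub_apply, Matrix.smul_apply, one_apply, of_apply, Fin.ext_iff, smul_eq_mul]
  rw [sum_upper_bidiagonal_row_mul hi (u i)
    (fun k ↦ if k = j + 1 then l j else if k = j then 1 else 0)]
  have hlast : ¬ i + 1 < n → l i = 0 := fun h ↦ by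
    rwa [show i = n - 1 by omega]
  cases i with
  | zero =>
    rw [sum_lower_bidiagonal_row_zero_mul hi lh
      (fun k ↦ if k = j then uh k else if j = k + 1 then 1 else 0)]
    grind
  | succ i =>
    rw [sum_lower_bidiagonal_row_succ_mul hi lh
      (fun k ↦ if k = j then uh k else if j = k + 1 then 1 else 0)]
    have hprod : lh i * uh i = l i * u (i + 1) := by
      rw [hlh i hi, div_mul_cancel₀ _ (hne i hi)]
    have hdiag := hrec i hi
    clear hne hlh hrec h1
    grind
end

section
/- Correctness of the dqds(σ) recurrence: with L, U as in the context and σ ∈ F, define d_1 = u_1 − σ and, for i = 1,…,n−1: û_i = d_i + l_i, l̂_i = l_i·(u_{i+1}/û_i), d_{i+1} = d_i·(u_{i+1}/û_i) − σ, and finally û_n = d_n, assuming û_i ≠ 0 for i = 1,…,n−1. Let L̂ be the unit lower bidiagonal matrix with subdiagonal entries l̂_1,…,l̂_{n−1} and Û the upper bidiagonal matrix with diagonal entries û_1,…,û_n and superdiagonal entries 1. Then L̂·Û = U·L − σ·I. -/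
open Matrix

/-- Applying a row of a lower bidiagonal matrix with unit diagonal. -/
theorem sum_lowerBidiagonal_mul {R : Type*} [Semiring R] {n : ℕ} (a f : ℕ → R) (i : Fin n) :
    ∑ k : Fin n, (if (i : ℕ) = (k : ℕ) + 1 then a k else if i = k then 1 else 0) * f k =
      f i + if 0 < (i : ℕ) then a (i - 1) * f (i - 1) else 0 := by
  obtain ⟨i, hi⟩ := i
  have split (k : Fin n) :
      (if i = (k : ℕ) + 1 then a k else if (⟨i, hi⟩ : Fin n) = k then 1 else 0) * f k =
        (if (⟨i, hi⟩ : Fin n) = k then f k else 0) + if i = (k : ℕ) + 1 then a k * f k else 0 := by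
    simp only [Fin.ext_iff]
    split_ifs <;> first | omega | simp
  simp only [split, Finset.sum_add_distrib, Finset.sum_ite_eq, Finset.mem_univ, if_true]
  congr 1
  rw [Fin.sum_univ_eq_sum_range (fun k => if i = k + 1 then a k * f k else 0)]
  cases i with
  | zero => simp
  | succ m => simp [show m < n by omega]

/-- Applying a row of an upper bidiagonal matrix with unit superdiagonal. -/
theorem sum_upperBidiagonal_mul {R : Type*} [Semiring R] {n : ℕ} (a f : ℕ → R) (i : Fin n) :
    ∑ k : Fin n, (if i = k then a i else if (k : ℕ) = (i : ℕ) + 1 then 1 else 0) * f k =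
      a i * f i + if (i : ℕ) + 1 < n then f (i + 1) else 0 := by
  obtain ⟨i, hi⟩ := i
  have split (k : Fin n) :
      (if (⟨i, hi⟩ : Fin n) = k then a i else if (k : ℕ) = i + 1 then 1 else 0) * f k =
        (if (⟨i, hi⟩ : Fin n) = k then a i * f k else 0) +
          if i + 1 = (k : ℕ) then f k else 0 := by
    simp only [Fin.ext_iff]
    split_ifs <;> first | omega | simp
  simp only [split, Finset.sum_add_distrib, Finset.sum_ite_eq, Finset.mem_univ, if_true]
  congr 1
  rw [Fin.sum_univ_eq_sum_range (fun k => if i + 1 = k then f k else 0)]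
  simp

/-- Correctness of the `dqds(σ)` recurrence: the computed factors satisfy
`L̂·Û = U·L − σ·I`. -/
theorem dqds_recurrence_correct {F : Type*} [Field F] {n : ℕ} (hn : 1 ≤ n)
    (l u lh uh d : ℕ → F) (σ : F)
    (L U Lh Uh : Matrix (Fin n) (Fin n) F)
    (hL : L = Matrix.of fun i j : Fin n =>
      if (i : ℕ) = (j : ℕ) + 1 then l (j : ℕ) else if i = j then 1 else 0)
    (hU : U = Matrix.of fun i j : Fin n =>
      if i = j then u (i : ℕ) else if (j : ℕ) = (i : ℕ) + 1 then 1 else 0)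
    (hLh : Lh = Matrix.of fun i j : Fin n =>
      if (i : ℕ) = (j : ℕ) + 1 then lh (j : ℕ) else if i = j then 1 else 0)
    (hUh : Uh = Matrix.of fun i j : Fin n =>
      if i = j then uh (i : ℕ) else if (j : ℕ) = (i : ℕ) + 1 then 1 else 0)
    -- the dqds(σ) recurrence
    (hd0 : d 0 = u 0 - σ)
    (huh : ∀ i : ℕ, i + 1 < n → uh i = d i + l i)
    (hne : ∀ i : ℕ, i + 1 < n → uh i ≠ 0)
    (hlh : ∀ i : ℕ, i + 1 < n → lh i = l i * (u (i + 1) / uh i))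
    (hd : ∀ i : ℕ, i + 1 < n → d (i + 1) = d i * (u (i + 1) / uh i) - σ)
    (huhn : uh (n - 1) = d (n - 1)) :
    Lh * Uh = U * L - σ • (1 : Matrix (Fin n) (Fin n) F) := by
  subst hL hU hLh hUh
  ext i j
  have hlow := sum_lowerBidiagonal_mul lh
    (fun k => if k = (j : ℕ) then uh k else if (j : ℕ) = k + 1 then 1 else 0) i
  have hupp := sum_upperBidiagonal_mul u
    (fun k => if k = (j : ℕ) + 1 then l j else if k = (j : ℕ) then 1 else 0) i
  simp only [Matrix.mul_apply, Matrix.sub_apply, Matrix.smul_apply, Matrix.one_apply,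
    Matrix.of_apply, smul_eq_mul]
  simp only [Fin.ext_iff] at hlow hupp ⊢
  rw [hlow, hupp]
  obtain ⟨i, hi⟩ := i
  obtain ⟨j, hj⟩ := j
  have hdiag : uh i = d i + if i + 1 < n then l i else 0 := by
    split_ifs with h
    · exact huh i h
    · obtain rfl : i = n - 1 := by omega
      simpa using huhn
  dsimp only
  rcases i with _ | m
  · rcases Nat.eq_zero_or_pos j with rfl | h
    · rw [hdiag, hd0]
      split_ifs <;> first | omega | simp_all
      ring
    · split_ifs <;> first | contradiction | omega | simp
  · have hne' := hne m hi
    have hsum : lh m + d (m + 1) = u (m + 1) - σ := by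
      have := huh m hi
      rw [hlh m hi, hd m hi]
      field_simp
      rw [this]
      ring
    have hprod : lh m * uh m = u (m + 1) * l m := by
      rw [hlh m hi]
      field_simp
    simp only [Nat.add_sub_cancel]
    by_cases h1 : j = m
    · subst h1
      simp [hprod, show ¬ j = j + 1 + 1 by omega, show ¬ j + 1 + 1 = j by omega]
    · by_cases h2 : j = m + 1
      · subst h2
        rw [hdiag]
        simp
        linear_combination hsum
      · split_ifs <;> first | omega | simp
end

section
/- Three dqds steps with shifts σ, σ̄−σ, −σ̄ restore the shift: let U1·L1 be a product of n×n complex matrices, let σ ∈ ℂ, and suppose L2·U2 = U1·L1 − σ·I, L3·U3 = U2·L2 − (σ̄−σ)·I, and L4·U4 = U3·L3 + σ̄·I, where L2 and L3 are unit lower triangular (hence invertible). Then L4·U4 = (L2·L3)⁻¹·(U1·L1)·(L2·L3); in particular L4·U4 is similar to U1·L1. -/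
open Matrix

/-- A unit lower triangular matrix has determinant one. -/
theorem det_eq_one_of_unit_lowerTriangular {n : ℕ} {R : Type*} [CommRing R]
    (L : Matrix (Fin n) (Fin n) R)
    (hlow : ∀ i j : Fin n, i < j → L i j = 0) (hdiag : ∀ i : Fin n, L i i = 1) :
    L.det = 1 := by
  rw [Matrix.det_of_isLowerTriangular L fun i j hij => hlow i j hij]
  simp [hdiag]

/-- Three dqds steps with shifts `σ`, `σ̄ − σ`, `−σ̄` restore the shift:
`L4·U4 = (L2·L3)⁻¹·(U1·L1)·(L2·L3)`, so `L4·U4` is similar to `U1·L1`. -/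
theorem triple_dqds_restores_shift {n : ℕ} (σ : ℂ)
    (U1 L1 L2 U2 L3 U3 L4 U4 : Matrix (Fin n) (Fin n) ℂ)
    (hL2low : ∀ i j : Fin n, i < j → L2 i j = 0) (hL2diag : ∀ i : Fin n, L2 i i = 1)
    (hL3low : ∀ i j : Fin n, i < j → L3 i j = 0) (hL3diag : ∀ i : Fin n, L3 i i = 1)
    (h2 : L2 * U2 = U1 * L1 - σ • (1 : Matrix (Fin n) (Fin n) ℂ))
    (h3 : L3 * U3 = U2 * L2 - ((starRingEnd ℂ) σ - σ) • (1 : Matrix (Fin n) (Fin n) ℂ))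
    (h4 : L4 * U4 = U3 * L3 + ((starRingEnd ℂ) σ) • (1 : Matrix (Fin n) (Fin n) ℂ)) :
    L4 * U4 = (L2 * L3)⁻¹ * (U1 * L1) * (L2 * L3) := by
  have hdet : IsUnit (L2 * L3).det := by
    simp [Matrix.det_mul, det_eq_one_of_unit_lowerTriangular L2 hL2low hL2diag,
      det_eq_one_of_unit_lowerTriangular L3 hL3low hL3diag]
  have key : (L2 * L3) * (L4 * U4) = (U1 * L1) * (L2 * L3) := by
    calc (L2 * L3) * (L4 * U4)
        = L2 * (L3 * U3) * L3 + (starRingEnd ℂ) σ • (L2 * L3) := by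
          rw [h4, mul_add, Matrix.mul_smul, mul_one]
          simp only [mul_assoc]
      _ = (L2 * U2) * (L2 * L3) + σ • (L2 * L3) := by
          rw [h3, mul_sub, sub_mul, Matrix.mul_smul, mul_one, Matrix.smul_mul, sub_smul]
          simp only [mul_assoc]
          abel
      _ = (U1 * L1) * (L2 * L3) := by
          rw [h2, sub_mul, Matrix.smul_mul, one_mul, sub_add_cancel]
  rw [mul_assoc, ← key, Matrix.nonsing_inv_mul_cancel_left _ _ hdet]
end

section
/- Two steps of Cholesky LR equal one step of QR: let A be an n×n real symmetric positive definite tridiagonal matrix. Let A = L1·L1ᵀ be its Cholesky factorization (L1 lower triangular with positive diagonal), set A2 = L1ᵀ·L1, let A2 = L2·L2ᵀ be the Cholesky factorization of A2, and set A3 = L2ᵀ·L2. Let A = Q·R with Q orthogonal and R upper triangular with positive diagonal entries, and set Â = R·Q. Then A3 = Â. -/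
open Matrix

/-- Two real upper triangular matrices with positive diagonals and equal Gram matrices agree
(uniqueness of the Cholesky factorization). -/
theorem eq_of_transpose_mul_self_eq_of_upper {n : ℕ} {R S : Matrix (Fin n) (Fin n) ℝ}
    (hRup : ∀ i j : Fin n, j < i → R i j = 0) (hRdiag : ∀ i : Fin n, 0 < R i i)
    (hSup : ∀ i j : Fin n, j < i → S i j = 0) (hSdiag : ∀ i : Fin n, 0 < S i i)
    (h : Rᵀ * R = Sᵀ * S) : R = S := by
  have row_eq (i : Fin n) : ∀ j, R i j = S i j := by
    induction i using WellFoundedLT.induction with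
    | ind i ih =>
    have mul_eq (j : Fin n) : R i i * R i j = S i i * S i j := by
      have hij := congrFun (congrFun h i) j
      simp only [mul_apply, transpose_apply] at hij
      rw [← Finset.add_sum_erase _ _ (Finset.mem_univ i),
        ← Finset.add_sum_erase _ (fun k => S k i * S k j) (Finset.mem_univ i)] at hij
      have rest : ∑ k ∈ Finset.univ.erase i, R k i * R k j =
          ∑ k ∈ Finset.univ.erase i, S k i * S k j := by
        refine Finset.sum_congr rfl fun k hk => ?_
        rcases lt_or_gt_of_ne (Finset.ne_of_mem_erase hk) with hki | hik
        · rw [ih k hki i, ih k hki j]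
        · rw [hRup k i hik, hSup k i hik, zero_mul, zero_mul]
      simpa only [rest, add_left_inj] using hij
    have diag_eq : R i i = S i i :=
      (mul_self_inj (hRdiag i).le (hSdiag i).le).mp (mul_eq i)
    intro j
    have hj := mul_eq j
    rw [diag_eq] at hj
    exact mul_left_cancel₀ (hSdiag i).ne' hj
  ext i j
  exact row_eq i j

/-- The product of two lower triangular matrices has the expected diagonal. -/
theorem mul_apply_diag_of_lower {n : ℕ} {L M : Matrix (Fin n) (Fin n) ℝ}
    (hL : ∀ i j : Fin n, i < j → L i j = 0) (hM : ∀ i j : Fin n, i < j → M i j = 0)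
    (i : Fin n) : (L * M) i i = L i i * M i i := by
  rw [mul_apply]
  refine Finset.sum_eq_single i (fun k _ hk => ?_) (by simp)
  rcases lt_or_gt_of_ne hk with hki | hik
  · rw [hM k i hki, mul_zero]
  · rw [hL i k hik, zero_mul]

/-- The product of two lower triangular matrices is lower triangular. -/
theorem mul_apply_eq_zero_of_lower {n : ℕ} {L M : Matrix (Fin n) (Fin n) ℝ}
    (hL : ∀ i j : Fin n, i < j → L i j = 0) (hM : ∀ i j : Fin n, i < j → M i j = 0)
    {i j : Fin n} (hij : i < j) : (L * M) i j = 0 := by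
  rw [mul_apply]
  refine Finset.sum_eq_zero fun k _ => ?_
  rcases lt_or_ge i k with hik | hki
  · rw [hL i k hik, zero_mul]
  · rw [hM k j (hki.trans_lt hij), mul_zero]

/-- Two steps of Cholesky LR equal one step of QR for a real symmetric positive definite
tridiagonal matrix: with `A = L1·L1ᵀ`, `A2 = L1ᵀ·L1 = L2·L2ᵀ`, `A3 = L2ᵀ·L2`, and
`A = Q·R` with `Q` orthogonal, `R` upper triangular with positive diagonal, one has
`A3 = R·Q`. -/
theorem two_cholesky_LR_eq_one_QR {n : ℕ}
    (A L1 L2 Q R : Matrix (Fin n) (Fin n) ℝ)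
    (hsym : A.IsSymm) (hpd : A.PosDef)
    (htri : ∀ i j : Fin n, ((i : ℕ) + 1 < (j : ℕ) ∨ (j : ℕ) + 1 < (i : ℕ)) → A i j = 0)
    (hL1low : ∀ i j : Fin n, i < j → L1 i j = 0) (hL1diag : ∀ i : Fin n, 0 < L1 i i)
    (hA : A = L1 * L1ᵀ)
    (hL2low : ∀ i j : Fin n, i < j → L2 i j = 0) (hL2diag : ∀ i : Fin n, 0 < L2 i i)
    (hA2 : L1ᵀ * L1 = L2 * L2ᵀ)
    (hQ : Qᵀ * Q = 1)
    (hRup : ∀ i j : Fin n, j < i → R i j = 0) (hRdiag : ∀ i : Fin n, 0 < R i i)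
    (hQR : A = Q * R) :
    L2ᵀ * L2 = R * Q := by
  have gram : Rᵀ * R = (L2ᵀ * L1ᵀ)ᵀ * (L2ᵀ * L1ᵀ) := by
    calc Rᵀ * R = Rᵀ * (Qᵀ * Q) * R := by rw [hQ, mul_one]
      _ = Aᵀ * A := by rw [hQR, transpose_mul]; simp only [mul_assoc]
      _ = L1 * (L1ᵀ * L1) * L1ᵀ := by rw [hsym.eq, hA]; simp only [mul_assoc]
      _ = _ := by
        rw [hA2, transpose_mul, transpose_transpose, transpose_transpose]
        simp only [mul_assoc]
  have hR : R = L2ᵀ * L1ᵀ := by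
    refine eq_of_transpose_mul_self_eq_of_upper hRup hRdiag (fun i j hji => ?_) (fun i => ?_) gram
    · rw [← transpose_mul, transpose_apply]
      exact mul_apply_eq_zero_of_lower hL1low hL2low hji
    · rw [← transpose_mul, transpose_apply, mul_apply_diag_of_lower hL1low hL2low]
      exact mul_pos (hL1diag i) (hL2diag i)
  have hRunit : IsUnit R :=
    isUnit_of_mul_isUnit_right (x := Q) (hQR ▸ hpd.isUnit)
  refine hRunit.mul_right_cancel ?_
  calc L2ᵀ * L2 * R = L2ᵀ * (L2 * L2ᵀ) * L1ᵀ := by rw [hR]; simp only [mul_assoc]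
    _ = R * A := by rw [← hA2, hR, hA]; simp only [mul_assoc]
    _ = R * Q * R := by rw [hQR, mul_assoc]
end

section
/- Reality of the double-shift LR transform: let J2 be an n×n matrix with real entries, regarded as complex, let σ ∈ ℂ, and suppose J2 − σ·I = L2·U2, J3 = U2·L2 + σ·I, J3 − σ̄·I = L3·U3, and J4 = U3·L3 + σ̄·I, where L2, L3 are complex unit lower triangular and U2, U3 are complex upper triangular. Let M = J2² − 2·Re(σ)·J2 + |σ|²·I (a real matrix), and assume the leading principal k×k submatrices of M are invertible for k = 1,…,n−1. Then all entries of J4 are real. -/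
open Matrix

/-- Leading principal submatrices of a product with lower triangular left factor. -/
theorem submatrix_castLE_mul_of_lower {R : Type*} [CommRing R] {k n : ℕ} (hk : k ≤ n)
    (L U : Matrix (Fin n) (Fin n) R) (hL : ∀ i j, i < j → L i j = 0) :
    (L * U).submatrix (Fin.castLE hk) (Fin.castLE hk) =
      L.submatrix (Fin.castLE hk) (Fin.castLE hk) *
        U.submatrix (Fin.castLE hk) (Fin.castLE hk) := by
  ext i j
  simp only [submatrix_apply, mul_apply]
  refine (Fintype.sum_of_injective (Fin.castLE hk) (Fin.castLE_injective hk) _ _ ?_ ?_).symm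
  · intro x hx
    have hkx : k ≤ (x : ℕ) := by
      by_contra! h
      exact hx ⟨⟨x, h⟩, rfl⟩
    rw [hL _ _ (Fin.lt_def.mpr (lt_of_lt_of_le i.isLt hkx)), zero_mul]
  · intro x
    rfl

/-- If a leading principal submatrix of `L * U` is invertible, with `L` lower and `U` upper
triangular, then the corresponding diagonal entries of `U` are nonzero. -/
theorem upper_diag_ne_zero_of_isUnit_submatrix {F : Type*} [Field F] {k n : ℕ} (hk : k ≤ n)
    (L U : Matrix (Fin n) (Fin n) F) (hL : ∀ i j, i < j → L i j = 0)
    (hU : ∀ i j, j < i → U i j = 0)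
    (h : IsUnit ((L * U).submatrix (Fin.castLE hk) (Fin.castLE hk))) (i : Fin k) :
    U (Fin.castLE hk i) (Fin.castLE hk i) ≠ 0 := by
  rw [submatrix_castLE_mul_of_lower hk L U hL, isUnit_iff_isUnit_det, det_mul,
    IsUnit.mul_iff] at h
  have hdet : (U.submatrix (Fin.castLE hk) (Fin.castLE hk)).det =
      ∏ i, U (Fin.castLE hk i) (Fin.castLE hk i) :=
    det_of_isUpperTriangular fun a b hab => hU _ _ hab
  exact Finset.prod_ne_zero_iff.mp (hdet ▸ h.2.ne_zero) i (Finset.mem_univ i)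

/-- A unit lower triangular matrix has determinant one. -/
theorem det_eq_one_of_unit_lower {R : Type*} [CommRing R] {n : ℕ}
    (L : Matrix (Fin n) (Fin n) R) (hL : ∀ i j, i < j → L i j = 0) (hd : ∀ i, L i i = 1) :
    L.det = 1 := by
  rw [det_of_isLowerTriangular L fun i j hij => hL i j hij]
  simp [hd]

/-- Uniqueness of the unit lower triangular factor in an `LU` factorization, where only the last
diagonal entry of `U` may vanish. -/
theorem unit_lower_factor_unique {F : Type*} [Field F] {n : ℕ}
    (L L' U U' : Matrix (Fin n) (Fin n) F)
    (hL : ∀ i j, i < j → L i j = 0) (hd : ∀ i, L i i = 1)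
    (hL' : ∀ i j, i < j → L' i j = 0) (hd' : ∀ i, L' i i = 1)
    (hU : ∀ i j, j < i → U i j = 0) (hU' : ∀ i j, j < i → U' i j = 0)
    (h : L * U = L' * U') (hne : ∀ j : Fin n, (j : ℕ) + 1 < n → U j j ≠ 0) :
    L = L' := by
  have hunit : IsUnit L'.det := by simp [det_eq_one_of_unit_lower L' hL' hd']
  let _ := L'.invertibleOfIsUnitDet hunit
  have hinv : BlockTriangular L'⁻¹ OrderDual.toDual :=
    blockTriangular_inv_of_blockTriangular fun i j hij => hL' i j hij
  have hLt : BlockTriangular L OrderDual.toDual := fun i j hij => hL i j hij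
  set D := L'⁻¹ * L with hDdef
  have hDlow : ∀ i j, i < j → D i j = 0 := fun i j hij => hinv.mul hLt hij
  have hDU : D * U = U' := by
    rw [hDdef, Matrix.mul_assoc, h, nonsing_inv_mul_cancel_left _ _ hunit]
  have hLD : L' * D = L := mul_nonsing_inv_cancel_left _ _ hunit
  have hDup : ∀ j i, j < i → D i j = 0 := by
    intro j
    induction j using WellFoundedLT.induction with
    | ind j ih =>
      intro i hji
      have hzero : ∑ x, D i x * U x j = 0 := by
        rw [← mul_apply, hDU, hU' i j hji]
      rw [Finset.sum_eq_single j] at hzero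
      · exact (mul_eq_zero.mp hzero).resolve_right (hne j (by omega))
      · intro x _ hx
        rcases lt_or_gt_of_ne hx with hx | hx
        · rw [ih x hx i (hx.trans hji), zero_mul]
        · rw [hU x j hx, mul_zero]
      · simp
  have hLcol : ∀ i j, L i j = L' i j * D j j := by
    intro i j
    rw [← hLD, mul_apply, Finset.sum_eq_single j]
    · intro x _ hx
      rcases lt_or_gt_of_ne hx with hx | hx
      · rw [hDlow x j hx, mul_zero]
      · rw [hDup j x hx, mul_zero]
    · simp
  ext i j
  have hj := hLcol j j
  rw [hd, hd', one_mul] at hj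
  rw [hLcol i j, ← hj, mul_one]

/-- Unit lower triangular matrices are closed under multiplication. -/
theorem unit_lower_mul {R : Type*} [CommRing R] {n : ℕ} (A B : Matrix (Fin n) (Fin n) R)
    (hA : ∀ i j, i < j → A i j = 0) (hAd : ∀ i, A i i = 1)
    (hB : ∀ i j, i < j → B i j = 0) (hBd : ∀ i, B i i = 1) :
    (∀ i j, i < j → (A * B) i j = 0) ∧ ∀ i, (A * B) i i = 1 := by
  refine ⟨fun i j hij => ?_, fun i => ?_⟩
  · have hA' : BlockTriangular A OrderDual.toDual := fun i j h => hA i j h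
    have hB' : BlockTriangular B OrderDual.toDual := fun i j h => hB i j h
    exact hA'.mul hB' hij
  · rw [mul_apply, Finset.sum_eq_single i]
    · rw [hAd, hBd, one_mul]
    · intro x _ hx
      rcases lt_or_gt_of_ne hx with hx | hx
      · rw [hB x i hx, mul_zero]
      · rw [hA i x hx, zero_mul]
    · simp

/-- Reality of the double-shift LR transform: if `J2` is real, the shifts are `σ` and `σ̄`,
and the leading principal submatrices of orders `1, …, n-1` of the real matrix
`M = J2² − 2·Re(σ)·J2 + |σ|²·I` are invertible, then `J4` is real. -/
theorem double_shift_LR_is_real {n : ℕ}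
    (J2 : Matrix (Fin n) (Fin n) ℝ) (σ : ℂ)
    (L2 U2 L3 U3 J3 J4 : Matrix (Fin n) (Fin n) ℂ)
    (hL2low : ∀ i j : Fin n, i < j → L2 i j = 0) (hL2diag : ∀ i : Fin n, L2 i i = 1)
    (hL3low : ∀ i j : Fin n, i < j → L3 i j = 0) (hL3diag : ∀ i : Fin n, L3 i i = 1)
    (hU2up : ∀ i j : Fin n, j < i → U2 i j = 0)
    (hU3up : ∀ i j : Fin n, j < i → U3 i j = 0)
    (h1 : J2.map Complex.ofReal - σ • (1 : Matrix (Fin n) (Fin n) ℂ) = L2 * U2)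
    (h2 : J3 = U2 * L2 + σ • (1 : Matrix (Fin n) (Fin n) ℂ))
    (h3 : J3 - ((starRingEnd ℂ) σ) • (1 : Matrix (Fin n) (Fin n) ℂ) = L3 * U3)
    (h4 : J4 = U3 * L3 + ((starRingEnd ℂ) σ) • (1 : Matrix (Fin n) (Fin n) ℂ))
    (M : Matrix (Fin n) (Fin n) ℝ)
    (hM : M = J2 ^ 2 - (2 * σ.re) • J2 + (Complex.normSq σ) • (1 : Matrix (Fin n) (Fin n) ℝ))
    (hminors : ∀ k : ℕ, 1 ≤ k → ∀ hk : k < n,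
      IsUnit (M.submatrix (Fin.castLE hk.le) (Fin.castLE hk.le))) :
    ∀ i j : Fin n, (J4 i j).im = 0 := by
  set A : Matrix (Fin n) (Fin n) ℂ := J2.map Complex.ofReal with hA
  set c : Matrix (Fin n) (Fin n) ℂ → Matrix (Fin n) (Fin n) ℂ :=
    fun X => X.map (starRingEnd ℂ) with hc
  have hcmul : ∀ X Y, c (X * Y) = c X * c Y := fun X Y => Matrix.map_mul
  have hcreal : ∀ X : Matrix (Fin n) (Fin n) ℝ,
      c (X.map Complex.ofReal) = X.map Complex.ofReal := by
    intro X
    ext i j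
    simp [hc]
  have hJ3 : L2 * J3 = A * L2 := by
    rw [h2, Matrix.mul_add, ← Matrix.mul_assoc, ← h1, Matrix.sub_mul]
    simp
  have hJ4 : L3 * J4 = J3 * L3 := by
    rw [h4, Matrix.mul_add, ← Matrix.mul_assoc, ← h3, Matrix.sub_mul]
    simp
  have hsim : L2 * L3 * J4 = A * (L2 * L3) := by
    rw [Matrix.mul_assoc, hJ4, ← Matrix.mul_assoc, hJ3, Matrix.mul_assoc]
  have hLU : M.map Complex.ofReal = L2 * L3 * (U3 * U2) := by
    have hfac : L2 * L3 * (U3 * U2) =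
        (A - (starRingEnd ℂ) σ • (1 : Matrix (Fin n) (Fin n) ℂ)) *
          (A - σ • (1 : Matrix (Fin n) (Fin n) ℂ)) := by
      calc L2 * L3 * (U3 * U2) = L2 * (L3 * U3) * U2 := by simp only [Matrix.mul_assoc]
        _ = (A - (starRingEnd ℂ) σ • (1 : Matrix (Fin n) (Fin n) ℂ)) * (L2 * U2) := by
          rw [← h3, Matrix.mul_sub, hJ3, ← Matrix.mul_assoc, Matrix.sub_mul A]
          simp
        _ = _ := by rw [← h1]
    have hsq : (J2 * J2).map Complex.ofReal = A * A :=
      Matrix.map_mul (f := Complex.ofRealHom)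
    have htr : (starRingEnd ℂ) σ + σ = ((2 * σ.re : ℝ) : ℂ) := by
      rw [add_comm, Complex.add_conj]
    have hnorm : (starRingEnd ℂ) σ * σ = ((Complex.normSq σ : ℝ) : ℂ) := by
      rw [mul_comm, Complex.mul_conj]
    have hexp : (A - (starRingEnd ℂ) σ • (1 : Matrix (Fin n) (Fin n) ℂ)) *
          (A - σ • (1 : Matrix (Fin n) (Fin n) ℂ)) =
        A * A - ((starRingEnd ℂ) σ + σ) • A +
          ((starRingEnd ℂ) σ * σ) • (1 : Matrix (Fin n) (Fin n) ℂ) := by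
      simp only [Matrix.sub_mul, Matrix.mul_sub, Matrix.smul_mul, Matrix.mul_smul,
        Matrix.one_mul, Matrix.mul_one]
      module
    rw [hfac, hexp, htr, hnorm, ← hsq, hM, pow_two]
    ext i j
    simp [hA, Matrix.one_apply, apply_ite Complex.ofReal]
  obtain ⟨hLlow, hLdiag⟩ := unit_lower_mul L2 L3 hL2low hL2diag hL3low hL3diag
  have hUup : ∀ i j : Fin n, j < i → (U3 * U2) i j = 0 := by
    have hU3 : BlockTriangular U3 id := fun i j h => hU3up i j h
    have hU2 : BlockTriangular U2 id := fun i j h => hU2up i j h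
    exact fun i j h => hU3.mul hU2 h
  have hne : ∀ j : Fin n, (j : ℕ) + 1 < n → (U3 * U2) j j ≠ 0 := by
    intro j hj
    refine upper_diag_ne_zero_of_isUnit_submatrix hj.le (L2 * L3) (U3 * U2) hLlow hUup ?_
      ⟨j, Nat.lt_succ_self j⟩
    rw [← hLU]
    exact (hminors (j + 1) (Nat.le_add_left 1 j) hj).map Complex.ofRealHom.mapMatrix
  have hLreal : L2 * L3 = c (L2 * L3) := by
    refine unit_lower_factor_unique _ _ (U3 * U2) (c (U3 * U2)) hLlow hLdiag ?_ ?_ hUup ?_ ?_ hne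
    · intro i j hij
      simp only [hc, map_apply, hLlow i j hij, map_zero]
    · intro i
      simp only [hc, map_apply, hLdiag i, map_one]
    · intro i j hij
      simp only [hc, map_apply, hUup i j hij, map_zero]
    · rw [← hcmul, ← hLU, hcreal]
  have hconj : L2 * L3 * c J4 = L2 * L3 * J4 := by
    conv_lhs => rw [hLreal, ← hcmul, hsim, hcmul, ← hLreal, hA, hcreal, ← hA]
    exact hsim.symm
  have hdet : IsUnit (L2 * L3).det := by
    rw [det_eq_one_of_unit_lower _ hLlow hLdiag]
    exact isUnit_one
  have hJ4real : c J4 = J4 := by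
    rw [← nonsing_inv_mul_cancel_left _ (c J4) hdet, hconj,
      nonsing_inv_mul_cancel_left _ J4 hdet]
  intro i j
  exact Complex.conj_eq_iff_im.mp (congrFun (congrFun hJ4real i) j)
end
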